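/- Let λ, C ∈ ℂ and let u, W, S : ℝ² → ℂ be smooth functions with u nowhere zero, S² = −W_x² + λW² + C, S_x = −2uW_x and W_xx = 2uS + λW on ℝ². Then the linear generalized invariant manifold relation holds: W_xxx − (u_x/u)W_xx + 4u²W_x = λ·(W_x − (u_x/u)W). (In operator form this is L₂W = λL₁W with L₁ = D_x − u_x/u and L₂ = D_x³ − (u_x/u)D_x² + 4u²D_x; the ratio yields the mKdV recursion operator R = D_x² + 4u² + 4u_x D_x⁻¹ u.) -/

import Mathlib

open Complex

/-- Partial derivative with respect to the first variable `x`. -/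
noncomputable def dX (f : ℝ → ℝ → ℂ) : ℝ → ℝ → ℂ := fun x t => deriv (fun y => f y t) x

/-- `f` is a smooth function of `(x,t) ∈ ℝ²`. -/
def Smooth2 (f : ℝ → ℝ → ℂ) : Prop := ContDiff ℝ (⊤ : ℕ∞) (fun p : ℝ × ℝ => f p.1 p.2)

/-- The restriction of a smooth function of `(x,t)` to a line `t = const` has `dX` as derivative. -/
theorem Smooth2.hasDerivAt {f : ℝ → ℝ → ℂ} (hf : Smooth2 f) (x t : ℝ) :
    HasDerivAt (fun y => f y t) (dX f x t) x := by
  have hline : ContDiff ℝ (⊤ : ℕ∞) (fun y : ℝ => f y t) :=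
    ContDiff.comp hf (contDiff_id.prodMk contDiff_const)
  exact (hline.differentiable (by simp) x).hasDerivAt

/-- From the nonlinear invariant manifold `W_xx = 2uS + λW`, `S² = −W_x² + λW² + C`,
`S_x = −2uW_x` of the mKdV equation one derives the linear generalized invariant
manifold relation `W_xxx − (u_x/u)W_xx + 4u²W_x = λ(W_x − (u_x/u)W)`. -/
theorem mkdv_linear_invariant_manifold
    (lam C : ℂ) (u W S : ℝ → ℝ → ℂ)
    (hu : Smooth2 u) (hW : Smooth2 W) (hS : Smooth2 S)
    (hune : ∀ x t, u x t ≠ 0)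
    (hS2 : ∀ x t, (S x t) ^ 2 = -(dX W x t) ^ 2 + lam * (W x t) ^ 2 + C)
    (hSx : ∀ x t, dX S x t = -2 * u x t * dX W x t)
    (hWxx : ∀ x t, dX (dX W) x t = 2 * u x t * S x t + lam * W x t) :
    ∀ x t, dX (dX (dX W)) x t - dX u x t / u x t * dX (dX W) x t
        + 4 * (u x t) ^ 2 * dX W x t
      = lam * (dX W x t - dX u x t / u x t * W x t) := by
  intro x t
  have hWxxx : dX (dX (dX W)) x t
      = 2 * dX u x t * S x t + 2 * u x t * dX S x t + lam * dX W x t := by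
    have hfun : (fun y => dX (dX W) y t) = fun y => 2 * u y t * S y t + lam * W y t :=
      funext fun y => hWxx y t
    change deriv (fun y => dX (dX W) y t) x = _
    rw [hfun]
    exact ((((hu.hasDerivAt x t).const_mul 2).mul (hS.hasDerivAt x t)).add
      ((hW.hasDerivAt x t).const_mul lam)).deriv
  have hux := hune x t
  rw [hWxxx, hSx, hWxx]
  field_simp
  ring
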